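/- Let m > 0, Δt > 0, let i ≤ j be indices, and let x_i, x_{i+1}, …, x_j be real numbers all strictly less than 0. Define the gradient recursion g_{i+1} = −x_i·Δt²/m and g_{l+1} = (1 − x_l·Δt²/m)·g_l for i+1 ≤ l ≤ j. Then g_{j+1} = (∏_{l=i+1}^{j} (1 − x_l·Δt²/m)) · (−x_i·Δt²/m), and g_{j+1} > 0. -/

import Mathlib

/-- A sequence satisfying `g (l + 1) = a l * g l` for `i < l ≤ j` is given by a product. -/
theorem eq_prod_Icc_mul_of_linear_recurrence {M : Type*} [CommMonoid M] {i j : ℕ} (hij : i ≤ j)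
    {a g : ℕ → M} (hg : ∀ l, i + 1 ≤ l → l ≤ j → g (l + 1) = a l * g l) :
    g (j + 1) = (∏ l ∈ Finset.Icc (i + 1) j, a l) * g (i + 1) := by
  induction j, hij using Nat.le_induction with
  | base => simp
  | succ k hk ih =>
    rw [hg (k + 1) (by lia) le_rfl, ih fun l h₁ h₂ => hg l h₁ (by lia),
      Finset.prod_Icc_succ_top (by lia), ← mul_assoc, mul_comm (a (k + 1))]

/-- Let `m > 0`, `Δt > 0`, `i ≤ j`, and let `x i, x (i+1), …, x j` be real
numbers all strictly less than `0`. Define the gradient recursion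
`g (i+1) = −x i·Δt²/m` and `g (l+1) = (1 − x l·Δt²/m)·g l` for `i+1 ≤ l ≤ j`. Then
`g (j+1) = (∏_{l=i+1}^{j} (1 − x l·Δt²/m)) · (−x i·Δt²/m)` and `g (j+1) > 0`. -/
theorem multi_collision_gradient_positive
    (m Δt : ℝ) (hm : 0 < m) (hdt : 0 < Δt)
    (i j : ℕ) (hij : i ≤ j)
    (x : ℕ → ℝ) (hx : ∀ l, i ≤ l → l ≤ j → x l < 0)
    (g : ℕ → ℝ)
    (hgi : g (i + 1) = -x i * Δt ^ 2 / m)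
    (hgrec : ∀ l, i + 1 ≤ l → l ≤ j → g (l + 1) = (1 - x l * Δt ^ 2 / m) * g l) :
    g (j + 1) =
        (∏ l ∈ Finset.Icc (i + 1) j, (1 - x l * Δt ^ 2 / m)) * (-x i * Δt ^ 2 / m) ∧
      0 < g (j + 1) := by
  have h_prod := eq_prod_Icc_mul_of_linear_recurrence hij hgrec
  rw [hgi] at h_prod
  have h_neg : ∀ l, i ≤ l → l ≤ j → x l * Δt ^ 2 / m < 0 := fun l h₁ h₂ =>
    div_neg_of_neg_of_pos (mul_neg_of_neg_of_pos (hx l h₁ h₂) (by positivity)) hm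
  refine ⟨h_prod, h_prod ▸ mul_pos (Finset.prod_pos fun l hl => ?_) ?_⟩
  · obtain ⟨h₁, h₂⟩ := Finset.mem_Icc.mp hl
    linarith [h_neg l (by lia) h₂]
  · rw [neg_mul, neg_div]
    exact neg_pos.mpr (h_neg i le_rfl hij)
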